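/- Let (T, Σ_C) be a safe DL-Lite_R TBox with closed predicates. Then for every UCQ q, every ABox A that is consistent w.r.t. (T, Σ_C), and every tuple a⃗ from Ind(A): A ⊨ (T, Σ_C, q)(a⃗) iff A ⊨ (T, ∅, q)(a⃗). -/

import Mathlib

namespace DL

/-- Roles: role names or inverse roles.  Role names are natural numbers. -/
inductive Role : Type
  | nm (r : ℕ) : Role
  | inv (r : ℕ) : Role
  deriving DecidableEq

/-- The inverse of a role. -/
def Role.flip : Role → Role
  | .nm r => .inv r
  | .inv r => .nm r

/-- The role name occurring in a role. -/
def Role.name : Role → ℕ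
  | .nm r => r
  | .inv r => r

/-- Interpretations.  Concept names, role names, and individual names are natural
numbers.  The standard name assumption is modelled by a partial, injective
interpretation `ind` of individual names: `ind a = some d` means that the individual
name `a` belongs to the domain and is (identified with) the element `d`. -/
structure Interp : Type 1 where
  Dom : Type
  dne : Nonempty Dom
  ind : ℕ → Option Dom
  ind_inj : ∀ a b d, ind a = some d → ind b = some d → a = b
  cInt : ℕ → Set Dom
  rInt : ℕ → Set (Dom × Dom)

/-- Extension of a (possibly inverse) role. -/
def Interp.rI (I : Interp) : Role → Set (I.Dom × I.Dom)
  | .nm r => I.rInt r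
  | .inv r => {p | (p.2, p.1) ∈ I.rInt r}

/-- ABoxes: sets of concept assertions `(A, a)` and role assertions `(r, a, b)`. -/
structure ABox : Type where
  ca : Set (ℕ × ℕ)
  ra : Set (ℕ × ℕ × ℕ)

/-- The individual names occurring in an ABox. -/
def ABox.ind (A : ABox) : Set ℕ :=
  {a | (∃ p ∈ A.ca, p.2 = a) ∨ (∃ t ∈ A.ra, t.2.1 = a ∨ t.2.2 = a)}

/-- The ABox is finite. -/
def ABox.Fin (A : ABox) : Prop := A.ca.Finite ∧ A.ra.Finite

/-- The ABox only uses concept names from `Sc` and role names from `Sr`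
(i.e. it is a `S`-ABox for the signature `S = Sc ∪ Sr`). -/
def ABox.usesOnly (A : ABox) (Sc Sr : Set ℕ) : Prop :=
  (∀ p ∈ A.ca, p.1 ∈ Sc) ∧ (∀ t ∈ A.ra, t.1 ∈ Sr)

/-- `I` is a model of the ABox `A` (under the standard name assumption). -/
def Interp.modelA (I : Interp) (A : ABox) : Prop :=
  (∀ p ∈ A.ca, ∃ d, I.ind p.2 = some d ∧ d ∈ I.cInt p.1) ∧
  (∀ t ∈ A.ra, ∃ d e, I.ind t.2.1 = some d ∧ I.ind t.2.2 = some e ∧ (d, e) ∈ I.rInt t.1)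

/-- `I` respects the closed predicates `Sc` (concept names) and `Sr` (role names)
with respect to the ABox `A`: the extension of each closed predicate is exactly
what is asserted in `A`. -/
def Interp.respects (I : Interp) (A : ABox) (Sc Sr : Set ℕ) : Prop :=
  (∀ B ∈ Sc, ∀ d, d ∈ I.cInt B ↔ ∃ a, I.ind a = some d ∧ (B, a) ∈ A.ca) ∧
  (∀ r ∈ Sr, ∀ d e, (d, e) ∈ I.rInt r ↔ ∃ a b, I.ind a = some d ∧ I.ind b = some e ∧ (r, a, b) ∈ A.ra)

/-- First-order queries built from concept atoms, role atoms and equality using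
negation, conjunction, disjunction and existential quantification.
Variables are natural numbers. -/
inductive FO : Type
  | eq (x y : ℕ)
  | capp (B x : ℕ)
  | rapp (r x y : ℕ)
  | neg (φ : FO)
  | conj (φ ψ : FO)
  | disj (φ ψ : FO)
  | ex (x : ℕ) (φ : FO)

/-- Standard first-order evaluation of a query in an interpretation under an
assignment. -/
def Interp.evalFO (I : Interp) : (ℕ → I.Dom) → FO → Prop
  | v, .eq x y => v x = v y
  | v, .capp B x => v x ∈ I.cInt B
  | v, .rapp r x y => (v x, v y) ∈ I.rInt r
  | v, .neg φ => ¬ I.evalFO v φ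
  | v, .conj φ ψ => I.evalFO v φ ∧ I.evalFO v ψ
  | v, .disj φ ψ => I.evalFO v φ ∨ I.evalFO v ψ
  | v, .ex x φ => ∃ d : I.Dom, I.evalFO (Function.update v x d) φ

/-- Free variables of a first-order query. -/
def FO.free : FO → Set ℕ
  | .eq x y => {x, y}
  | .capp _ x => {x}
  | .rapp _ x y => {x, y}
  | .neg φ => φ.free
  | .conj φ ψ => φ.free ∪ ψ.free
  | .disj φ ψ => φ.free ∪ ψ.free
  | .ex x φ => φ.free \ {x}

/-- Conjunctions of concept and role atoms. -/
inductive IsConjAtoms : FO → Prop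
  | capp (B x : ℕ) : IsConjAtoms (.capp B x)
  | rapp (r x y : ℕ) : IsConjAtoms (.rapp r x y)
  | conj {φ ψ : FO} : IsConjAtoms φ → IsConjAtoms ψ → IsConjAtoms (.conj φ ψ)

/-- Conjunctive queries: existentially quantified conjunctions of atoms. -/
inductive IsCQ : FO → Prop
  | base {φ : FO} : IsConjAtoms φ → IsCQ φ
  | ex {φ : FO} (x : ℕ) : IsCQ φ → IsCQ (.ex x φ)

/-- Unions of conjunctive queries: disjunctions of CQs. -/
inductive IsUCQ : FO → Prop
  | base {φ : FO} : IsCQ φ → IsUCQ φ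
  | disj {φ ψ : FO} : IsUCQ φ → IsUCQ ψ → IsUCQ (.disj φ ψ)

/-- `v` maps the answer variables `xs` to (the domain elements named by) the
individual names `as`. -/
def matches' (I : Interp) (xs as : List ℕ) (v : ℕ → I.Dom) : Prop :=
  ∀ p ∈ List.zip xs as, I.ind p.2 = some (v p.1)

/-- `I ⊨ q(as)`, where `xs` is the list of answer variables of `q`. -/
def Interp.sat (I : Interp) (q : FO) (xs as : List ℕ) : Prop :=
  ∃ v : ℕ → I.Dom, matches' I xs as v ∧ I.evalFO v q

/-- Certain answers of the ontology-mediated query with closed predicates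
`(T, Σ_C, q)` where the models of the TBox `T` are given by the predicate `mod`:
`as` is a certain answer to `q` (with answer variables `xs`) over `A` iff every
model of the TBox and `A` that respects the closed predicates satisfies `q(as)`. -/
def certAns (mod : Interp → Prop) (Sc Sr : Set ℕ) (A : ABox) (q : FO) (xs as : List ℕ) : Prop :=
  ∀ I : Interp, mod I → I.modelA A → I.respects A Sc Sr → I.sat q xs as

/-- `A` is consistent w.r.t. the TBox (given by `mod`) and the closed predicates. -/
def consistentW (mod : Interp → Prop) (Sc Sr : Set ℕ) (A : ABox) : Prop :=
  ∃ I : Interp, mod I ∧ I.modelA A ∧ I.respects A Sc Sr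

/-- DL-Lite basic concepts: concept names and unqualified existential
restrictions `∃ρ` over (possibly inverse) roles. -/
inductive Basic : Type
  | atom (B : ℕ)
  | ex (ρ : Role)
  deriving DecidableEq

/-- Semantics of basic concepts. -/
def Interp.semB (I : Interp) : Basic → Set I.Dom
  | .atom B => I.cInt B
  | .ex ρ => {d | ∃ e, (d, e) ∈ I.rI ρ}

/-- DL-Lite_R axioms: positive and negative concept inclusions between
basic concepts, and role inclusions. -/
inductive LiteAx : Type
  | pos (B₁ B₂ : Basic)
  | npos (B₁ B₂ : Basic)
  | ri (ρ σ : Role)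

/-- A DL-Lite_R TBox is a finite list of axioms. -/
abbrev LiteTBox := List LiteAx

/-- `I` is a model of the DL-Lite_R TBox `T`. -/
def Interp.modelLite (I : Interp) (T : LiteTBox) : Prop :=
  (∀ B₁ B₂ : Basic, LiteAx.pos B₁ B₂ ∈ T → I.semB B₁ ⊆ I.semB B₂) ∧
  (∀ B₁ B₂ : Basic, LiteAx.npos B₁ B₂ ∈ T → I.semB B₁ ∩ I.semB B₂ = ∅) ∧
  (∀ ρ σ : Role, LiteAx.ri ρ σ ∈ T → I.rI ρ ⊆ I.rI σ)

/-- `T ⊨ B₁ ⊑ B₂`. -/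
def liteEntPos (T : LiteTBox) (B₁ B₂ : Basic) : Prop :=
  ∀ I : Interp, I.modelLite T → I.semB B₁ ⊆ I.semB B₂

/-- `T ⊨ B₁ ⊑ ¬B₂`. -/
def liteEntNeg (T : LiteTBox) (B₁ B₂ : Basic) : Prop :=
  ∀ I : Interp, I.modelLite T → I.semB B₁ ∩ I.semB B₂ = ∅

/-- `T ⊨ ρ ⊑ σ`. -/
def liteEntRI (T : LiteTBox) (ρ σ : Role) : Prop :=
  ∀ I : Interp, I.modelLite T → I.rI ρ ⊆ I.rI σ

/-- `B` is satisfiable w.r.t. `T`. -/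
def liteSat (T : LiteTBox) (B : Basic) : Prop :=
  ∃ I : Interp, I.modelLite T ∧ (I.semB B).Nonempty

/-- Concept names occurring in a basic concept. -/
def Basic.sigC : Basic → Set ℕ
  | .atom B => {B}
  | .ex _ => ∅

/-- Role names occurring in a basic concept. -/
def Basic.sigR : Basic → Set ℕ
  | .atom _ => ∅
  | .ex ρ => {ρ.name}

/-- Safeness of a DL-Lite_R TBox with closed predicates `(T, S_C)` where
`S_C` consists of the concept names `Sc` and the role names `Sr`. -/
def LiteSafe (T : LiteTBox) (Sc Sr : Set ℕ) : Prop :=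
  ¬ ∃ (B₁ B₂ : Basic) (ρ : Role),
      liteSat T B₁ ∧
      liteEntPos T B₁ (.ex ρ) ∧ liteEntPos T (.ex ρ.flip) B₂ ∧
      (∀ ρ' : Role, liteEntRI T ρ' ρ → B₁ ≠ .ex ρ') ∧
      (B₂.sigC ⊆ Sc ∧ B₂.sigR ⊆ Sr) ∧
      (∀ ρ' : Role, liteEntPos T B₁ (.ex ρ') → liteEntRI T ρ' ρ → ρ'.name ∉ Sr)

@[simp] theorem Role.flip_flip (ρ : Role) : ρ.flip.flip = ρ := by cases ρ <;> rfl

theorem Interp.mem_rI_flip (I : Interp) (ρ : Role) (x y : I.Dom) :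
    (x, y) ∈ I.rI ρ.flip ↔ (y, x) ∈ I.rI ρ := by
  cases ρ <;> rfl

theorem liteEntRI.flip {T : LiteTBox} {ρ σ : Role} (h : liteEntRI T ρ σ) :
    liteEntRI T ρ.flip σ.flip := by
  rintro I hI ⟨x, y⟩ hxy
  rw [I.mem_rI_flip] at hxy ⊢
  exact h I hI hxy

theorem liteEntRI.ex {T : LiteTBox} {ρ σ : Role} (h : liteEntRI T ρ σ) :
    liteEntPos T (.ex ρ) (.ex σ) := by
  rintro I hI x ⟨y, hxy⟩
  exact ⟨y, h I hI hxy⟩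

theorem liteEntPos.trans {T : LiteTBox} {B C D : Basic} (h : liteEntPos T B C)
    (h' : liteEntPos T C D) : liteEntPos T B D :=
  fun I hI _ hx => h' I hI (h I hI hx)

theorem liteEntPos.refl (T : LiteTBox) (B : Basic) : liteEntPos T B B :=
  fun _ _ _ hx => hx

/-- The ABox asserts the basic concept `B` at the individual name `a`. -/
inductive ABox.Asserts (A : ABox) : ℕ → Basic → Prop
  | atom {B a : ℕ} : (B, a) ∈ A.ca → A.Asserts a (.atom B)
  | nm {r a b : ℕ} : (r, a, b) ∈ A.ra → A.Asserts a (.ex (.nm r))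
  | inv {r a b : ℕ} : (r, b, a) ∈ A.ra → A.Asserts a (.ex (.inv r))

theorem ABox.Asserts.exists_mem_semB {A : ABox} {I : Interp} (hI : I.modelA A) {a : ℕ}
    {B : Basic} (h : A.Asserts a B) : ∃ d, I.ind a = some d ∧ d ∈ I.semB B := by
  cases h with
  | atom h => exact hI.1 _ h
  | nm h =>
    obtain ⟨d, e, hd, -, hde⟩ := hI.2 _ h
    exact ⟨d, hd, e, hde⟩
  | inv h =>
    obtain ⟨d, e, -, he, hde⟩ := hI.2 _ h
    exact ⟨e, he, d, hde⟩

/-- Instances of `B` need a fresh `ρ`-successor: `T ⊨ B ⊑ ∃ρ`, and a `ρ`-successor is guaranteed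
neither by `B` itself nor through a closed role. -/
def NeedsFresh (T : LiteTBox) (Sr : Set ℕ) (B : Basic) (ρ : Role) : Prop :=
  liteEntPos T B (.ex ρ) ∧ (∀ ρ' : Role, liteEntRI T ρ' ρ → B ≠ .ex ρ') ∧
    ∀ ρ' : Role, liteEntPos T B (.ex ρ') → liteEntRI T ρ' ρ → ρ'.name ∉ Sr

/-- `B` consists of closed predicates only. -/
def Basic.Closed (Sc Sr : Set ℕ) (B : Basic) : Prop := B.sigC ⊆ Sc ∧ B.sigR ⊆ Sr

theorem LiteSafe.not_closed {T : LiteTBox} {Sc Sr : Set ℕ} (hsafe : LiteSafe T Sc Sr)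
    {B C : Basic} {ρ : Role} (hB : liteSat T B) (h : NeedsFresh T Sr B ρ)
    (hC : liteEntPos T (.ex ρ.flip) C) : ¬ C.Closed Sc Sr :=
  fun hcl => hsafe ⟨B, C, ρ, hB, h.1, hC, h.2.1, hcl, h.2.2⟩

namespace Chase

/-- Elements of the chase of an ABox guided by `I`: individual names, and fresh elements `(e, ρ)`
that copy `e` and were introduced as `ρ`-successors. -/
abbrev Elem (I : Interp) : Type := ℕ ⊕ (I.Dom × Role)

/-- The projection of the chase to the guiding interpretation. -/
noncomputable def proj (I : Interp) : Elem I → I.Dom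
  | .inl a => (I.ind a).getD I.dne.some
  | .inr p => p.1

/-- The basic concepts that generate the type of a chase element. -/
inductive Base (T : LiteTBox) (Sr : Set ℕ) (A : ABox) (I : Interp) : Elem I → Basic → Prop
  | named {a : ℕ} {B : Basic} : A.Asserts a B → Base T Sr A I (.inl a) B
  | fresh {x : Elem I} {B : Basic} {ρ : Role} {e : I.Dom} : Base T Sr A I x B →
      NeedsFresh T Sr B ρ → (proj I x, e) ∈ I.rI ρ → Base T Sr A I (.inr (e, ρ)) (.ex ρ.flip)

/-- The edges from which the roles of the chase are generated. -/
inductive Edge (T : LiteTBox) (Sr : Set ℕ) (A : ABox) (I : Interp) :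
    Role → Elem I → Elem I → Prop
  | named {r a b : ℕ} : (r, a, b) ∈ A.ra → Edge T Sr A I (.nm r) (.inl a) (.inl b)
  | fresh {x : Elem I} {B : Basic} {ρ : Role} {e : I.Dom} : Base T Sr A I x B →
      NeedsFresh T Sr B ρ → (proj I x, e) ∈ I.rI ρ → Edge T Sr A I ρ x (.inr (e, ρ))
  | flip {x y : Elem I} {ρ : Role} : Edge T Sr A I ρ x y → Edge T Sr A I ρ.flip y x

/-- The chase of the ABox `A`, guided by the interpretation `I`. -/
def interp (T : LiteTBox) (Sr : Set ℕ) (A : ABox) (I : Interp) : Interp where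
  Dom := Elem I
  dne := ⟨.inl 0⟩
  ind a := some (.inl a)
  ind_inj _ _ _ ha hb := Sum.inl_injective (Option.some_injective _ (ha.trans hb.symm))
  cInt C := {x | ∃ B, Base T Sr A I x B ∧ liteEntPos T B (.atom C)}
  rInt r := {p | ∃ ρ, Edge T Sr A I ρ p.1 p.2 ∧ liteEntRI T ρ (.nm r)}

variable {T : LiteTBox} {Sc Sr : Set ℕ} {A : ABox} {I : Interp}

theorem mem_rI {σ : Role} {x y : Elem I} :
    (x, y) ∈ (interp T Sr A I).rI σ ↔ ∃ ρ, Edge T Sr A I ρ x y ∧ liteEntRI T ρ σ := by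
  cases σ with
  | nm r => rfl
  | inv r =>
    constructor
    · rintro ⟨ρ, h, hr⟩
      exact ⟨ρ.flip, h.flip, hr.flip⟩
    · rintro ⟨ρ, h, hr⟩
      exact ⟨ρ.flip, h.flip, hr.flip⟩

theorem proj_eq {a : ℕ} {d : I.Dom} (h : I.ind a = some d) : proj I (.inl a) = d := by
  simp [proj, h]

theorem Base.proj_mem (hA : I.modelA A) {x : Elem I} {B : Basic} (h : Base T Sr A I x B) :
    proj I x ∈ I.semB B := by
  cases h with
  | named h =>
    obtain ⟨d, hd, hB⟩ := h.exists_mem_semB hA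
    rwa [proj_eq hd]
  | @fresh x _ _ _ _ _ he => exact ⟨proj I x, (I.mem_rI_flip _ _ _).2 he⟩

theorem Edge.proj_mem (hA : I.modelA A) {ρ : Role} {x y : Elem I} (h : Edge T Sr A I ρ x y) :
    (proj I x, proj I y) ∈ I.rI ρ := by
  induction h with
  | named h =>
    obtain ⟨d, e, hd, he, hde⟩ := hA.2 _ h
    rwa [proj_eq hd, proj_eq he]
  | fresh _ _ he => exact he
  | flip _ ih => exact (I.mem_rI_flip _ _ _).2 ih

theorem proj_mem_rI (hT : I.modelLite T) (hA : I.modelA A) {σ : Role} {x y : Elem I}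
    (h : (x, y) ∈ (interp T Sr A I).rI σ) : (proj I x, proj I y) ∈ I.rI σ := by
  obtain ⟨ρ, h, hr⟩ := mem_rI.1 h
  exact hr I hT (h.proj_mem hA)

theorem proj_mem_semB (hT : I.modelLite T) (hA : I.modelA A) {B : Basic} {x : Elem I}
    (h : x ∈ (interp T Sr A I).semB B) : proj I x ∈ I.semB B := by
  cases B with
  | atom C =>
    obtain ⟨B, hB, hBC⟩ := h
    exact hBC I hT (hB.proj_mem hA)
  | ex σ =>
    obtain ⟨y, hy⟩ := h
    exact ⟨proj I y, proj_mem_rI hT hA hy⟩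

theorem Base.not_closed (hsafe : LiteSafe T Sc Sr) (hT : I.modelLite T) (hA : I.modelA A)
    {p : I.Dom × Role} {B C : Basic} (h : Base T Sr A I (.inr p) B) (hC : liteEntPos T B C) :
    ¬ C.Closed Sc Sr := by
  cases h with
  | fresh hB hn _ => exact hsafe.not_closed ⟨I, hT, _, hB.proj_mem hA⟩ hn hC

/-- Every edge is witnessed by generating concepts at both of its ends. -/
theorem Edge.exists_base {ρ : Role} {x y : Elem I} (h : Edge T Sr A I ρ x y) :
    (∃ B, Base T Sr A I x B ∧ liteEntPos T B (.ex ρ)) ∧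
      ∃ B, Base T Sr A I y B ∧ liteEntPos T B (.ex ρ.flip) := by
  induction h with
  | named h =>
    exact ⟨⟨_, .named (.nm h), .refl _ _⟩, ⟨_, .named (.inv h), .refl _ _⟩⟩
  | fresh hB hn he => exact ⟨⟨_, hB, hn.1⟩, ⟨_, .fresh hB hn he, .refl _ _⟩⟩
  | flip _ ih => exact ⟨ih.2, by simpa using ih.1⟩

theorem Base.exists_edge {x : Elem I} {ρ : Role} (h : Base T Sr A I x (.ex ρ)) :
    ∃ y, Edge T Sr A I ρ x y := by
  generalize hB : Basic.ex ρ = B at h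
  cases h with
  | named h =>
    cases h with
    | atom => cases hB
    | nm h => cases hB; exact ⟨_, .named h⟩
    | inv h => cases hB; exact ⟨_, (Edge.named h).flip⟩
  | fresh h hn he => cases hB; exact ⟨_, (Edge.fresh h hn he).flip⟩

/-- Closed roles entailed at an individual name by a consistent ABox are asserted. -/
theorem exists_edge_of_closed {I₀ : Interp} (hT₀ : I₀.modelLite T) (hA₀ : I₀.modelA A)
    (hR₀ : I₀.respects A Sc Sr) {a : ℕ} {B : Basic} {ρ : Role} (hB : A.Asserts a B)
    (hBρ : liteEntPos T B (.ex ρ)) (hρ : ρ.name ∈ Sr) :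
    ∃ y, Edge T Sr A I ρ (.inl a) y := by
  obtain ⟨d, hd, hdB⟩ := hB.exists_mem_semB hA₀
  obtain ⟨e, he⟩ := hBρ I₀ hT₀ hdB
  cases ρ with
  | nm r =>
    obtain ⟨a', b, ha', -, hr⟩ := (hR₀.2 r hρ d e).1 he
    obtain rfl := I₀.ind_inj _ _ _ ha' hd
    exact ⟨_, .named hr⟩
  | inv r =>
    obtain ⟨b, a', -, ha', hr⟩ := (hR₀.2 r hρ e d).1 he
    obtain rfl := I₀.ind_inj _ _ _ ha' hd
    exact ⟨_, (Edge.named hr).flip⟩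

theorem mem_semB (hsafe : LiteSafe T Sc Sr) (hT : I.modelLite T) (hA : I.modelA A)
    {I₀ : Interp} (hT₀ : I₀.modelLite T) (hA₀ : I₀.modelA A) (hR₀ : I₀.respects A Sc Sr)
    {C : Basic} {x : Elem I} :
    x ∈ (interp T Sr A I).semB C ↔ ∃ B, Base T Sr A I x B ∧ liteEntPos T B C := by
  cases C with
  | atom C => rfl
  | ex σ =>
    constructor
    · rintro ⟨y, hy⟩
      obtain ⟨ρ, h, hr⟩ := mem_rI.1 hy
      obtain ⟨B, hB, hBρ⟩ := h.exists_base.1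
      exact ⟨B, hB, hBρ.trans hr.ex⟩
    · rintro ⟨B, hB, hBσ⟩
      suffices ∃ ρ y, Edge T Sr A I ρ x y ∧ liteEntRI T ρ σ by
        obtain ⟨ρ, y, h⟩ := this
        exact ⟨y, mem_rI.2 ⟨ρ, h⟩⟩
      by_cases hn : NeedsFresh T Sr B σ
      · obtain ⟨e, he⟩ := hn.1 I hT (hB.proj_mem hA)
        exact ⟨σ, _, .fresh hB hn he, fun _ _ _ h => h⟩
      by_cases hex : ∃ ρ, liteEntRI T ρ σ ∧ B = .ex ρ
      · obtain ⟨ρ, hr, rfl⟩ := hex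
        obtain ⟨y, hy⟩ := hB.exists_edge
        exact ⟨ρ, y, hy, hr⟩
      obtain ⟨ρ, hBρ, hr, hρ⟩ :
          ∃ ρ, liteEntPos T B (.ex ρ) ∧ liteEntRI T ρ σ ∧ ρ.name ∈ Sr := by
        by_contra! hcl
        push Not at hex
        exact hn ⟨hBσ, hex, hcl⟩
      cases x with
      | inl a =>
        cases hB with
        | named hB =>
          obtain ⟨y, hy⟩ := exists_edge_of_closed hT₀ hA₀ hR₀ hB hBρ hρ
          exact ⟨ρ, y, hy, hr⟩
      | inr p =>
        exact absurd ⟨Set.empty_subset _, Set.singleton_subset_iff.2 hρ⟩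
          (hB.not_closed hsafe hT hA hBρ)

theorem modelA : (interp T Sr A I).modelA A :=
  ⟨fun _ h => ⟨_, rfl, _, .named (.atom h), .refl _ _⟩,
    fun _ h => ⟨_, _, rfl, rfl, _, .named h, fun _ _ _ h => h⟩⟩

theorem modelLite (hsafe : LiteSafe T Sc Sr) (hT : I.modelLite T) (hA : I.modelA A)
    {I₀ : Interp} (hT₀ : I₀.modelLite T) (hA₀ : I₀.modelA A) (hR₀ : I₀.respects A Sc Sr) :
    (interp T Sr A I).modelLite T := by
  refine ⟨fun B₁ B₂ hax x hx => ?_, fun B₁ B₂ hax => ?_, ?_⟩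
  · obtain ⟨B, hB, hB₁⟩ := (mem_semB hsafe hT hA hT₀ hA₀ hR₀).1 hx
    exact (mem_semB hsafe hT hA hT₀ hA₀ hR₀).2
      ⟨B, hB, hB₁.trans fun J hJ => hJ.1 B₁ B₂ hax⟩
  · refine Set.eq_empty_of_forall_notMem fun x hx => ?_
    have hmem : proj I x ∈ I.semB B₁ ∩ I.semB B₂ :=
      ⟨proj_mem_semB hT hA hx.1, proj_mem_semB hT hA hx.2⟩
    rw [hT.2.1 B₁ B₂ hax] at hmem
    exact hmem
  · rintro ρ σ hax ⟨x, y⟩ hxy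
    obtain ⟨τ, h, hr⟩ := mem_rI.1 hxy
    exact mem_rI.2 ⟨τ, h, fun J hJ => (hr J hJ).trans (hJ.2.2 ρ σ hax)⟩

/-- An edge between individual names is an edge in every model of the ABox. -/
theorem Edge.exists_mem_rI {I₀ : Interp} (hA₀ : I₀.modelA A) {ρ : Role} {x y : Elem I}
    (h : Edge T Sr A I ρ x y) {a b : ℕ} (ha : x = .inl a) (hb : y = .inl b) :
    ∃ d e, I₀.ind a = some d ∧ I₀.ind b = some e ∧ (d, e) ∈ I₀.rI ρ := by
  induction h generalizing a b with
  | named h => cases ha; cases hb; exact hA₀.2 _ h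
  | fresh => cases hb
  | flip _ ih =>
    obtain ⟨d, e, hd, he, h⟩ := ih hb ha
    exact ⟨e, d, he, hd, (I₀.mem_rI_flip _ _ _).2 h⟩

theorem respects (hsafe : LiteSafe T Sc Sr) (hT : I.modelLite T) (hA : I.modelA A)
    {I₀ : Interp} (hT₀ : I₀.modelLite T) (hA₀ : I₀.modelA A) (hR₀ : I₀.respects A Sc Sr) :
    (interp T Sr A I).respects A Sc Sr := by
  refine ⟨fun C hC x => ⟨?_, ?_⟩, fun r hr x y => ⟨?_, ?_⟩⟩
  · rintro ⟨B, hB, hBC⟩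
    cases x with
    | inl a =>
      cases hB with
      | named hB =>
        obtain ⟨d, hd, hdB⟩ := hB.exists_mem_semB hA₀
        obtain ⟨a', ha', hmem⟩ := (hR₀.1 C hC d).1 (hBC I₀ hT₀ hdB)
        obtain rfl := I₀.ind_inj _ _ _ ha' hd
        exact ⟨_, rfl, hmem⟩
    | inr p =>
      exact absurd ⟨Set.singleton_subset_iff.2 hC, Set.empty_subset _⟩
        (hB.not_closed hsafe hT hA hBC)
  · rintro ⟨a, ha, hmem⟩
    obtain rfl := Option.some_injective _ ha
    exact ⟨_, .named (.atom hmem), .refl _ _⟩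
  · rintro ⟨ρ, h, hρ⟩
    obtain ⟨⟨B, hB, hBρ⟩, ⟨B', hB', hBρ'⟩⟩ := h.exists_base
    cases x with
    | inr p =>
      exact absurd ⟨Set.empty_subset _, Set.singleton_subset_iff.2 hr⟩
        (hB.not_closed hsafe hT hA (hBρ.trans hρ.ex))
    | inl a =>
      cases y with
      | inr p =>
        exact absurd ⟨Set.empty_subset _, Set.singleton_subset_iff.2 hr⟩
          (hB'.not_closed hsafe hT hA (hBρ'.trans hρ.flip.ex))
      | inl b =>
        obtain ⟨d, e, hd, he, hde⟩ := h.exists_mem_rI hA₀ rfl rfl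
        obtain ⟨a', b', ha', hb', hmem⟩ := (hR₀.2 r hr d e).1 (hρ I₀ hT₀ hde)
        obtain rfl := I₀.ind_inj _ _ _ ha' hd
        obtain rfl := I₀.ind_inj _ _ _ hb' he
        exact ⟨_, _, rfl, rfl, hmem⟩
  · rintro ⟨a, b, ha, hb, hmem⟩
    obtain rfl := Option.some_injective _ ha
    obtain rfl := Option.some_injective _ hb
    exact ⟨_, .named hmem, fun _ _ _ h => h⟩

end Chase

/-- `f` is a homomorphism on concept and role names. -/
def IsHom (I J : Interp) (f : I.Dom → J.Dom) : Prop :=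
  (∀ B x, x ∈ I.cInt B → f x ∈ J.cInt B) ∧
    ∀ r x y, (x, y) ∈ I.rInt r → (f x, f y) ∈ J.rInt r

theorem IsHom.evalFO_conjAtoms {I J : Interp} {f : I.Dom → J.Dom} (hf : IsHom I J f) {q : FO}
    (hq : IsConjAtoms q) {v : ℕ → I.Dom} (h : I.evalFO v q) : J.evalFO (f ∘ v) q := by
  induction hq with
  | capp B x => exact hf.1 _ _ h
  | rapp r x y => exact hf.2 _ _ _ h
  | conj _ _ ih₁ ih₂ => exact ⟨ih₁ h.1, ih₂ h.2⟩

theorem IsHom.evalFO_cq {I J : Interp} {f : I.Dom → J.Dom} (hf : IsHom I J f) {q : FO}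
    (hq : IsCQ q) {v : ℕ → I.Dom} (h : I.evalFO v q) : J.evalFO (f ∘ v) q := by
  induction hq generalizing v with
  | base hq => exact hf.evalFO_conjAtoms hq h
  | ex x _ ih =>
    obtain ⟨d, hd⟩ := h
    refine ⟨f d, ?_⟩
    rw [← Function.comp_update]
    exact ih hd

theorem IsHom.evalFO_ucq {I J : Interp} {f : I.Dom → J.Dom} (hf : IsHom I J f) {q : FO}
    (hq : IsUCQ q) {v : ℕ → I.Dom} (h : I.evalFO v q) : J.evalFO (f ∘ v) q := by
  induction hq with
  | base hq => exact hf.evalFO_cq hq h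
  | disj _ _ ih₁ ih₂ => exact h.imp ih₁ ih₂

theorem Interp.modelA.exists_ind {I : Interp} {A : ABox} (hI : I.modelA A) {a : ℕ}
    (ha : a ∈ A.ind) : ∃ d, I.ind a = some d := by
  rcases ha with ⟨p, hp, rfl⟩ | ⟨t, ht, h⟩
  · obtain ⟨d, hd, -⟩ := hI.1 p hp
    exact ⟨d, hd⟩
  · obtain ⟨d, e, hd, he, -⟩ := hI.2 t ht
    rcases h with rfl | rfl
    exacts [⟨d, hd⟩, ⟨e, he⟩]

/-- Let `(T, S_C)` be a safe DL-Lite_R TBox with closed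
predicates.  Then for every UCQ `q`, every (finite) ABox `A` that is consistent
w.r.t. `(T, S_C)`, and every tuple `as` from `Ind(A)`:
`A ⊨ (T, S_C, q)(as)` iff `A ⊨ (T, ∅, q)(as)`. -/
theorem statement_6 (T : LiteTBox) (Sc Sr : Set ℕ)
    (hfin : Sc.Finite ∧ Sr.Finite) (hsafe : LiteSafe T Sc Sr)
    (q : FO) (hq : IsUCQ q) (xs : List ℕ) (hfree : q.free ⊆ {x | x ∈ xs})
    (A : ABox) (hA : A.Fin)
    (hcons : consistentW (fun I => I.modelLite T) Sc Sr A)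
    (as : List ℕ) (hlen : as.length = xs.length) (hind : ∀ a ∈ as, a ∈ A.ind) :
    certAns (fun I => I.modelLite T) Sc Sr A q xs as ↔
    certAns (fun I => I.modelLite T) ∅ ∅ A q xs as := by
  constructor
  · intro h I hT hI _
    obtain ⟨I₀, hT₀, hA₀, hR₀⟩ := hcons
    obtain ⟨v, hv, hvq⟩ := h (Chase.interp T Sr A I)
      (Chase.modelLite hsafe hT hI hT₀ hA₀ hR₀) Chase.modelA
      (Chase.respects hsafe hT hI hT₀ hA₀ hR₀)
    have hom : IsHom (Chase.interp T Sr A I) I (Chase.proj I) :=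
      ⟨fun B _ hx => Chase.proj_mem_semB (B := .atom B) hT hI hx,
        fun r _ _ hxy => Chase.proj_mem_rI (σ := .nm r) hT hI hxy⟩
    refine ⟨Chase.proj I ∘ v, fun p hp => ?_, hom.evalFO_ucq hq hvq⟩
    obtain ⟨d, hd⟩ := hI.exists_ind (hind p.2 (List.of_mem_zip hp).2)
    have hvp : v p.1 = .inl p.2 := (Option.some_injective _ (hv p hp)).symm
    exact hd.trans (congrArg some ((congrArg (Chase.proj I) hvp).trans (Chase.proj_eq hd)).symm)
  · intro h I hT hI _
    exact h I hT hI ⟨fun _ hB => hB.elim, fun _ hr => hr.elim⟩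

end DL
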